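/- arXiv:1307.8247 — 6 statements merged into one kernel-verified Lean document; each statement's English description precedes it below -/
import Mathlib

section
/- For all z, z' ∈ L*(Q), the pointwise minimum min(z,z') and the pointwise maximum max(z,z') again belong to L*(Q). Consequently L*(Q) is an infinite distributive lattice in which the join z ∨ z' is the pointwise minimum, the meet z ∧ z' is the pointwise maximum, and the maximum element is the zero function. -/
/-!
Setup: a quiver is given by a vertex type `V`, an arrow type `E`, and source/target maps
`src tgt : E → V`.  `DCost src tgt x y n` says that there is a path from `x` to `y` in the
double quiver `Q̃` using exactly `n` forward arrows, and `lQ src tgt x y` is the minimal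
such `n` (this is `l_Q(x, y)`; it is well defined when the quiver is connected).
-/

/-- `DCost src tgt x y n`: there is a path from `x` to `y` in the double quiver with
exactly `n` forward arrows. -/
inductive DCost {V E : Type*} (src tgt : E → V) : V → V → ℕ → Prop
  | refl (x : V) : DCost src tgt x x 0
  | fwd {x : V} {n : ℕ} (e : E) : DCost src tgt x (src e) n → DCost src tgt x (tgt e) (n + 1)
  | bwd {x : V} {n : ℕ} (e : E) : DCost src tgt x (tgt e) n → DCost src tgt x (src e) n

/-- `l_Q(x, y)`: the minimal number of forward arrows on a path from `x` to `y` in the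
double quiver. -/
noncomputable def lQ {V E : Type*} (src tgt : E → V) (x y : V) : ℕ :=
  sInf {n : ℕ | DCost src tgt x y n}

/-- The quiver is connected (its double quiver joins any two vertices by a path). -/
def QConnected {V E : Type*} (src tgt : E → V) : Prop :=
  ∀ x y : V, ∃ n : ℕ, DCost src tgt x y n

/-- The quiver has no loops. -/
def NoLoops {V E : Type*} (src tgt : E → V) : Prop := ∀ e : E, src e ≠ tgt e

/-- The quiver has no oriented cycles. -/
def NoOrientedCycles {V E : Type*} (src tgt : E → V) : Prop :=
  ∀ x : V, ¬ Relation.TransGen (fun a b : V => ∃ e : E, src e = a ∧ tgt e = b) x x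

/-- Condition (C): every vertex is incident to at least two arrows. -/
def CondC {V E : Type*} (src tgt : E → V) : Prop :=
  ∀ a : V, 2 ≤ Nat.card {e : E // src e = a ∨ tgt e = a}

/-- `L*(Q)`: the set of functions `z : Q₀ → ℕ` with `z a ≤ z b + l_Q(b, a)` for all
`a, b ∈ Q₀`, ordered by `z ≤ z'` iff `z a ≥ z' a` for all `a` (opposite pointwise order). -/
def LstarSet {V E : Type*} (src tgt : E → V) : Set (V → ℕ) :=
  {z | ∀ a b : V, z a ≤ z b + lQ src tgt b a}

/-- For all `z, z' ∈ L*(Q)` the pointwise minimum and the pointwise maximum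
again belong to `L*(Q)`; consequently `L*(Q)` is an infinite distributive lattice (for the
order `z ≤ z'` iff `z a ≥ z' a` pointwise) in which the join is the pointwise minimum,
the meet is the pointwise maximum, and the maximum element is the zero function. -/
theorem stmt1 {V E : Type*} [Fintype V] [Fintype E] [Nonempty V] (src tgt : E → V)
    (hconn : QConnected src tgt) (hloops : NoLoops src tgt)
    (hacyc : NoOrientedCycles src tgt) :
    (∀ z ∈ LstarSet src tgt, ∀ z' ∈ LstarSet src tgt,
      (fun a => min (z a) (z' a)) ∈ LstarSet src tgt ∧
      (fun a => max (z a) (z' a)) ∈ LstarSet src tgt) ∧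
    (LstarSet src tgt).Infinite ∧
    -- the join is the pointwise minimum: it is the least upper bound in the opposite order
    (∀ z ∈ LstarSet src tgt, ∀ z' ∈ LstarSet src tgt, ∀ w ∈ LstarSet src tgt,
      (((∀ a, w a ≤ z a) ∧ ∀ a, w a ≤ z' a) ↔ ∀ a, w a ≤ min (z a) (z' a))) ∧
    -- the meet is the pointwise maximum: it is the greatest lower bound in the opposite order
    (∀ z ∈ LstarSet src tgt, ∀ z' ∈ LstarSet src tgt, ∀ w ∈ LstarSet src tgt,
      (((∀ a, z a ≤ w a) ∧ ∀ a, z' a ≤ w a) ↔ ∀ a, max (z a) (z' a) ≤ w a)) ∧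
    -- distributivity: (x ∨ y) ∧ w = (x ∧ w) ∨ (y ∧ w)
    (∀ z ∈ LstarSet src tgt, ∀ z' ∈ LstarSet src tgt, ∀ w ∈ LstarSet src tgt, ∀ a : V,
      max (min (z a) (z' a)) (w a) = min (max (z a) (w a)) (max (z' a) (w a))) ∧
    -- the zero function is the maximum element
    ((fun _ : V => 0) ∈ LstarSet src tgt ∧
      ∀ z ∈ LstarSet src tgt, ∀ a : V, (fun _ : V => 0) a ≤ z a) := by
  have hconst (n : ℕ) : (fun _ : V => n) ∈ LstarSet src tgt := fun _ _ => Nat.le_add_right _ _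
  refine ⟨fun z hz z' hz' => ⟨fun a b => ?_, fun a b => ?_⟩, ?_,
    fun z _ z' _ w _ => ?_, fun z _ z' _ w _ => ?_, fun z _ z' _ w _ a => max_min_distrib_right _ _ _,
    hconst 0, fun z _ a => Nat.zero_le _⟩
  · have h₁ := hz a b
    have h₂ := hz' a b
    dsimp only
    omega
  · have h₁ := hz a b
    have h₂ := hz' a b
    dsimp only
    omega
  · exact Set.infinite_of_injective_forall_mem (Function.const_injective (α := V) (β := ℕ)) hconst
  · simp only [le_min_iff, forall_and]
  · simp only [max_le_iff, forall_and]
end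

section
/- Assume Q satisfies condition (C). An element z ∈ L*(Q) is join-irreducible in the lattice L*(Q) (i.e., z = z' ∨ z'' implies z' = z or z'' = z, where the join z' ∨ z'' is the pointwise minimum) if and only if there exist a ∈ Q₀ and r ∈ ℕ with z(x) = r + l_Q(a,x) for all x ∈ Q₀. -/
section Helpers

variable {V E : Type*} {src tgt : E → V}

theorem DCost.trans {x y z : V} {m n : ℕ} (hxy : DCost src tgt x y m)
    (hyz : DCost src tgt y z n) : DCost src tgt x z (m + n) := by
  induction hyz with
  | refl => exact hxy
  | fwd e _ ih => exact .fwd e ih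
  | bwd e _ ih => exact .bwd e ih

theorem lQ_self (x : V) : lQ src tgt x x = 0 :=
  Nat.sInf_eq_zero.2 (.inl (.refl x))

theorem dcost_lQ (hconn : QConnected src tgt) (x y : V) :
    DCost src tgt x y (lQ src tgt x y) :=
  Nat.sInf_mem (hconn x y)

theorem lQ_triangle (hconn : QConnected src tgt) (x y z : V) :
    lQ src tgt x z ≤ lQ src tgt x y + lQ src tgt y z :=
  Nat.sInf_le ((dcost_lQ hconn x y).trans (dcost_lQ hconn y z))

theorem add_lQ_mem_LstarSet (hconn : QConnected src tgt) (a : V) (r : ℕ) :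
    (fun x => r + lQ src tgt a x) ∈ LstarSet src tgt := fun x y => by
  have := lQ_triangle hconn a y x
  dsimp only
  omega

theorem infClosed_LstarSet : InfClosed (LstarSet src tgt) := fun f hf g hg a b => by
  have := hf a b
  have := hg a b
  simp only [Pi.inf_apply]
  omega

/-- An element that is irreducible for `⊓` in an inf-closed set and is a finite nonempty infimum
of members of the set is one of those members. -/
theorem InfClosed.exists_eq_of_inf'_eq {α ι : Type*} [SemilatticeInf α] {S : Set α}
    (hS : InfClosed S) {z : α}
    (hirr : ∀ f ∈ S, ∀ g ∈ S, z = f ⊓ g → f = z ∨ g = z) {f : ι → α} (hf : ∀ i, f i ∈ S)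
    {s : Finset ι} (hs : s.Nonempty) (hz : z = s.inf' hs f) : ∃ i ∈ s, f i = z := by
  induction hs using Finset.Nonempty.cons_induction with
  | singleton i => exact ⟨i, by simp, by simpa using hz.symm⟩
  | cons i s hi hs ih =>
    rw [Finset.inf'_cons hs] at hz
    rcases hirr _ (hf i) _ (hS.finsetInf'_mem hs fun j _ => hf j) hz with h | h
    · exact ⟨i, by simp, h⟩
    · obtain ⟨j, hj, h⟩ := ih h.symm
      exact ⟨j, by simp [hj], h⟩

end Helpers

/-- Assume `Q` satisfies condition (C).  An element `z ∈ L*(Q)` is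
join-irreducible in the lattice `L*(Q)` (where the join is the pointwise minimum) if and
only if there exist `a ∈ Q₀` and `r ∈ ℕ` with `z x = r + l_Q(a, x)` for all `x ∈ Q₀`. -/
theorem stmt3 {V E : Type*} [Fintype V] [Fintype E] [Nonempty V] (src tgt : E → V)
    (hconn : QConnected src tgt) (hloops : NoLoops src tgt)
    (hacyc : NoOrientedCycles src tgt) (hC : CondC src tgt) :
    ∀ z ∈ LstarSet src tgt,
      ((∀ z' ∈ LstarSet src tgt, ∀ z'' ∈ LstarSet src tgt,
          (∀ a : V, z a = min (z' a) (z'' a)) → z' = z ∨ z'' = z) ↔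
        ∃ (a : V) (r : ℕ), ∀ x : V, z x = r + lQ src tgt a x) := by
  intro z hz
  constructor
  · intro hirr
    have hinf : z = Finset.univ.inf' Finset.univ_nonempty
        (fun a x => z a + lQ src tgt a x) := by
      funext x
      rw [Finset.inf'_apply]
      refine le_antisymm (Finset.le_inf' _ _ fun a _ => hz x a) ?_
      exact (Finset.inf'_le _ (Finset.mem_univ x)).trans_eq (by rw [lQ_self, add_zero])
    obtain ⟨a, -, ha⟩ := infClosed_LstarSet.exists_eq_of_inf'_eq
      (fun f hf g hg h => hirr f hf g hg fun a => congrFun h a)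
      (fun a => add_lQ_mem_LstarSet hconn a (z a)) Finset.univ_nonempty hinf
    exact ⟨a, z a, fun x => (congrFun ha x).symm⟩
  · rintro ⟨a, r, hr⟩ f hf g hg h
    have ha : z a = r := by rw [hr, lQ_self, add_zero]
    rcases min_choice (f a) (g a) with hm | hm
    · refine .inl (funext fun x => ?_)
      have := hf x a
      have := hr x
      have := h x
      have := h a
      omega
    · refine .inr (funext fun x => ?_)
      have := hg x a
      have := hr x
      have := h x
      have := h a
      omega
end

section
/- If (L,τ⁻¹) satisfies conditions (c0), (c1) and (c2), then for every x ∈ L the upper set {y ∈ L : y ≥ x} is finite. -/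
/-!
Setup: an infinite distributive lattice `L` with maximum element (`⊤`) and a map
`t = τ⁻¹ : L → L` which is injective, preserves binary joins and meets, reflects
and preserves the order, and maps covering pairs to covering pairs.

A covering pair is encoded as `p : L × L` with `p.2 ⋖ p.1` (i.e. `p.1` covers `p.2`,
written `p.1 ⋗ p.2` in the paper).
-/

/-- The generating relation for the equivalence `∼` on covering pairs:
(a) `(x ⋗ y) ∼ (τ⁻¹x ⋗ τ⁻¹y)`; (b) `(x ⋗ y) ∼ (x' ⋗ y')` whenever `x ⋗ x'` and `y ⋗ y'`. -/
def CPGen {L : Type*} [PartialOrder L] (t : L → L) (p q : L × L) : Prop :=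
  (p.2 ⋖ p.1 ∧ q = (t p.1, t p.2)) ∨
  (p.2 ⋖ p.1 ∧ q.2 ⋖ q.1 ∧ q.1 ⋖ p.1 ∧ q.2 ⋖ p.2)

/-- The equivalence relation `∼` on covering pairs: the smallest equivalence relation
containing the generating relation `CPGen`. -/
def CPeq {L : Type*} [PartialOrder L] (t : L → L) : L × L → L × L → Prop :=
  Relation.EqvGen (CPGen t)

/-- `t = τ⁻¹` is injective, preserves binary joins and meets, reflects and preserves
the order, and maps covering pairs to covering pairs. -/
structure TauMap {L : Type*} [Lattice L] (t : L → L) : Prop where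
  inj : Function.Injective t
  map_sup : ∀ x y : L, t (x ⊔ y) = t x ⊔ t y
  map_inf : ∀ x y : L, t (x ⊓ y) = t x ⊓ t y
  le_iff : ∀ x y : L, x ≤ y ↔ t x ≤ t y
  cov : ∀ x y : L, x ⋖ y → t x ⋖ t y

/-- `P := L ∖ τ⁻¹(L)`. -/
def TauP {L : Type*} (t : L → L) : Set L := {x | x ∉ Set.range t}

/-- `w 0 ⋗ w 1 ⋗ ⋯ ⋗ w r` is a covering chain. -/
def IsCovChain {L : Type*} [PartialOrder L] (w : ℕ → L) (r : ℕ) : Prop :=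
  ∀ i < r, w (i + 1) ⋖ w i

/-- (c0): `P` is nonempty and finite. -/
def CondC0 {L : Type*} (t : L → L) : Prop := (TauP t).Nonempty ∧ (TauP t).Finite

/-- (c1): every element of `L` equals `τ^{-r} p` for a unique pair `(r, p) ∈ ℕ × P`. -/
def CondC1 {L : Type*} (t : L → L) : Prop :=
  ∀ x : L, ∃! rp : ℕ × L, rp.2 ∈ TauP t ∧ t^[rp.1] rp.2 = x

/-- (c2): for all `x, y ∈ P` and `r > 0`, `x < τ^{-r} y` fails. -/
def CondC2 {L : Type*} [PartialOrder L] (t : L → L) : Prop :=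
  ∀ x ∈ TauP t, ∀ y ∈ TauP t, ∀ r : ℕ, 0 < r → ¬ x < t^[r] y

/-- (c3): `x ⋗ y` implies `y ≥ τ⁻¹ x`. -/
def CondC3 {L : Type*} [PartialOrder L] (t : L → L) : Prop :=
  ∀ x y : L, y ⋖ x → t x ≤ y

/-- (c4): for every `x ∈ P` there is a covering chain from `x` to `τ⁻¹x` whose covering
pairs lie in pairwise distinct `∼`-classes forming a complete set of representatives of `Λ`. -/
def CondC4 {L : Type*} [PartialOrder L] (t : L → L) : Prop :=
  ∀ x ∈ TauP t, ∃ (r : ℕ) (w : ℕ → L), w 0 = x ∧ w r = t x ∧ IsCovChain w r ∧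
    (∀ i < r, ∀ j < r, i ≠ j → ¬ CPeq t (w i, w (i + 1)) (w j, w (j + 1))) ∧
    (∀ p : L × L, p.2 ⋖ p.1 → ∃ i < r, CPeq t (w i, w (i + 1)) p)

/-- `φ(w, λ)` for a covering chain `w` of length `r`, with the class `λ` represented by a
covering pair `p`: the number of indices whose covering pair is `∼`-equivalent to `p`. -/
noncomputable def chainCnt {L : Type*} [PartialOrder L] (t : L → L) (w : ℕ → L) (r : ℕ) (p : L × L) : ℕ :=
  Set.ncard {i : ℕ | i < r ∧ CPeq t (w i, w (i + 1)) p}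

open scoped Classical in
/-- `φ(x)_λ` (`λ` represented by the covering pair `p`), computed from a covering chain
from the maximum element `⊤` to `x`. -/
noncomputable def phi {L : Type*} [PartialOrder L] [OrderTop L] (t : L → L) (x : L)
    (p : L × L) : ℕ :=
  if h : ∃ (w : ℕ → L) (r : ℕ), w 0 = ⊤ ∧ w r = x ∧ IsCovChain w r then
    chainCnt t h.choose h.choose_spec.choose p
  else 0

/-- Iterates of `t` reflect the order. -/
theorem TauMap.le_of_iterate_le {L : Type*} [Lattice L] {t : L → L} (ht : TauMap t)
    (n : ℕ) {x y : L} (h : t^[n] x ≤ t^[n] y) : x ≤ y := by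
  induction n with
  | zero => exact h
  | succ n ih =>
    rw [Function.iterate_succ_apply', Function.iterate_succ_apply'] at h
    exact ih ((ht.le_iff _ _).mpr h)

/-- Under (c2), `τ^{-r} p ≤ τ^{-s} q` with `p, q ∈ P` forces `s ≤ r`. -/
theorem CondC2.le_of_iterate_le {L : Type*} [Lattice L] {t : L → L} (hc2 : CondC2 t)
    (ht : TauMap t) {p q : L} (hp : p ∈ TauP t) (hq : q ∈ TauP t) {r s : ℕ}
    (h : t^[r] p ≤ t^[s] q) : s ≤ r := by
  by_contra! hlt
  obtain ⟨k, rfl⟩ := Nat.exists_eq_add_of_lt hlt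
  rw [add_assoc, Function.iterate_add_apply] at h
  rcases (ht.le_of_iterate_le r h).eq_or_lt with heq | hl
  · exact hp ⟨t^[k] q, by rw [heq, Function.iterate_succ_apply']⟩
  · exact hc2 p hp q hq (k + 1) k.succ_pos hl

/-- If `(L, τ⁻¹)` satisfies conditions (c0), (c1) and (c2), then for every
`x ∈ L` the upper set `{y ∈ L : y ≥ x}` is finite. -/
theorem stmt5 {L : Type*} [DistribLattice L] [OrderTop L] [Infinite L] (t : L → L)
    (ht : TauMap t) (hc0 : CondC0 t) (hc1 : CondC1 t) (hc2 : CondC2 t) :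
    ∀ x : L, {y : L | x ≤ y}.Finite := by
  intro x
  obtain ⟨⟨r, p⟩, ⟨hp, rfl⟩, -⟩ := hc1 x
  refine (((Set.finite_Iic r).prod hc0.2).image fun a : ℕ × L => t^[a.1] a.2).subset ?_
  intro y hy
  obtain ⟨⟨s, q⟩, ⟨hq, rfl⟩, -⟩ := hc1 y
  exact ⟨(s, q), ⟨hc2.le_of_iterate_le ht hp hq hy, hq⟩, rfl⟩
end

section
/- If (L,τ⁻¹) satisfies conditions (c0)–(c4), then for all x, y ∈ L with x > y there exists a covering chain x = x₀ ⋗ x₁ ⋗ ⋯ ⋗ x_r = y; in particular the Hasse quiver of L is connected. -/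
/-- Two elements related by a finite sequence of covering steps are joined by a covering chain. -/
theorem exists_isCovChain_of_reflTransGen {L : Type*} [PartialOrder L] {x y : L}
    (h : Relation.ReflTransGen (· ⋖ ·) y x) :
    ∃ (r : ℕ) (w : ℕ → L), w 0 = x ∧ w r = y ∧ IsCovChain w r := by
  induction h using Relation.ReflTransGen.head_induction_on with
  | refl => exact ⟨0, fun _ => x, rfl, rfl, fun i hi => absurd hi (Nat.not_lt_zero i)⟩
  | @head a c hac _ ih =>
    obtain ⟨r, w, h0, hr, hw⟩ := ih
    refine ⟨r + 1, fun i => if i ≤ r then w i else a, by simpa using h0, by simp, ?_⟩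
    intro i hi
    rcases Nat.lt_succ_iff_lt_or_eq.mp hi with hlt | rfl
    · simpa [hlt.le, Nat.succ_le_of_lt hlt] using hw i hlt
    · simpa [hr] using hac

/-- Iterates of `τ⁻¹` preserve and reflect the order. -/
theorem TauMap.iterate_le_iff {L : Type*} [Lattice L] {t : L → L} (ht : TauMap t) (n : ℕ)
    (x y : L) : t^[n] x ≤ t^[n] y ↔ x ≤ y := by
  induction n with
  | zero => rfl
  | succ n ih => rw [Function.iterate_succ_apply', Function.iterate_succ_apply', ← ht.le_iff, ih]

/-- If `P` is finite and (c1), (c2) hold, every principal up-set is finite. -/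
theorem TauMap.finite_Ici {L : Type*} [Lattice L] {t : L → L} (ht : TauMap t)
    (hfin : (TauP t).Finite) (hc1 : CondC1 t) (hc2 : CondC2 t) (y : L) : (Set.Ici y).Finite := by
  obtain ⟨⟨s, q⟩, ⟨hq, rfl⟩, -⟩ := hc1 y
  refine (((Set.finite_Iic s).prod hfin).image fun kp : ℕ × L => t^[kp.1] kp.2).subset ?_
  intro z hz
  obtain ⟨⟨k, p⟩, ⟨hp, rfl⟩, -⟩ := hc1 z
  refine ⟨(k, p), ⟨?_, hp⟩, rfl⟩
  by_contra! hk
  obtain ⟨d, rfl⟩ : ∃ d, k = s + (d + 1) := Nat.exists_eq_add_of_lt (not_le.mp hk)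
  have hle : q ≤ t^[d + 1] p := by
    rw [Set.mem_Ici, Function.iterate_add_apply, ht.iterate_le_iff] at hz
    exact hz
  refine hc2 q hq p hp (d + 1) d.succ_pos (hle.lt_of_ne fun he => hq ⟨t^[d] p, ?_⟩)
  rw [he, Function.iterate_succ_apply']

/-- If `(L, τ⁻¹)` satisfies (c0)–(c4), then for all `x, y ∈ L` with `x > y`
there is a covering chain `x = w 0 ⋗ w 1 ⋗ ⋯ ⋗ w r = y`; in particular the Hasse quiver
of `L` is connected. -/
theorem stmt6 {L : Type*} [DistribLattice L] [OrderTop L] [Infinite L] (t : L → L)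
    (ht : TauMap t) (hc0 : CondC0 t) (hc1 : CondC1 t) (hc2 : CondC2 t) (hc3 : CondC3 t)
    (hc4 : CondC4 t) :
    ∀ x y : L, y < x → ∃ (r : ℕ) (w : ℕ → L), w 0 = x ∧ w r = y ∧ IsCovChain w r := by
  intro x y hxy
  let _ : LocallyFiniteOrder L := LocallyFiniteOrder.ofFiniteIcc fun a b =>
    (ht.finite_Ici hc0.2 hc1 hc2 a).subset Set.Icc_subset_Ici_self
  exact exists_isCovChain_of_reflTransGen (le_iff_reflTransGen_covBy.mp hxy.le)
end

section
/- If (L,τ⁻¹) satisfies conditions (c0)–(c4) and w, w' are covering chains in L with the same first element and the same last element, then φ(w,λ) = φ(w',λ) for every λ ∈ Λ. -/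
/-- `WeightedCovPath c n x z k`: there is a covering chain of length `n` from `x` down to `z`
whose covering pairs have total weight `k` with respect to `c`. -/
inductive WeightedCovPath {L : Type*} [PartialOrder L] (c : L → L → ℕ) : ℕ → L → L → ℕ → Prop
  | nil (x : L) : WeightedCovPath c 0 x x 0
  | cons {n k : ℕ} {x y z : L} (hxy : y ⋖ x) (hyz : WeightedCovPath c n y z k) :
      WeightedCovPath c (n + 1) x z (c x y + k)

namespace WeightedCovPath

theorem le {L : Type*} [PartialOrder L] {c : L → L → ℕ} {n k : ℕ} {x z : L}
    (h : WeightedCovPath c n x z k) : z ≤ x := by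
  induction h with
  | nil x => exact le_rfl
  | cons hxy _ ih => exact ih.trans hxy.le

theorem of_isCovChain {L : Type*} [PartialOrder L] (c : L → L → ℕ) (r : ℕ) (w : ℕ → L)
    (hw : IsCovChain w r) :
    WeightedCovPath c r (w 0) (w r) (∑ i ∈ Finset.range r, c (w i) (w (i + 1))) := by
  induction r generalizing w with
  | zero => exact nil _
  | succ r ih =>
    rw [Finset.sum_range_succ', add_comm (Finset.sum _ _)]
    exact cons (hw 0 (by omega)) (ih (fun i => w (i + 1)) fun i hi => hw (i + 1) (by omega))

/-- In a modular lattice, a covering chain from `x` to `z` yields one from any intermediate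
element to `z`. -/
theorem exists_of_mem_Icc {L : Type*} [Lattice L] [IsModularLattice L] {c : L → L → ℕ}
    {n k : ℕ} {x z : L} (h : WeightedCovPath c n x z k) {d : L} (hzd : z ≤ d) (hdx : d ≤ x) :
    ∃ m l, WeightedCovPath c m d z l := by
  induction h generalizing d with
  | nil x =>
    obtain rfl := le_antisymm hzd hdx
    exact ⟨0, 0, nil _⟩
  | @cons n k x y z hxy hyz ih =>
    by_cases hdy : d ≤ y
    · exact ih hzd hdy
    · have hsup : d ⊔ y = x :=
        (hxy.eq_or_eq le_sup_right (sup_le hdx hxy.le)).resolve_left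
          fun h => hdy (h ▸ le_sup_left)
      obtain ⟨m, l, hp⟩ := ih (le_inf hzd hyz.le) inf_le_right
      exact ⟨_, _, cons (inf_covBy_of_covBy_sup_right (hsup.symm ▸ hxy)) hp⟩

/-- Jordan–Hölder with weights: if opposite sides of every covering diamond have equal weight,
then the length and the weight of a covering chain depend only on its end points. -/
theorem unique {L : Type*} [Lattice L] [IsModularLattice L] {c : L → L → ℕ}
    (hc : ∀ x a b d : L, a ⋖ x → b ⋖ x → d ⋖ a → d ⋖ b → c x a = c b d)
    {n m k l : ℕ} {x z : L}
    (h : WeightedCovPath c n x z k) (h' : WeightedCovPath c m x z l) : n = m ∧ k = l := by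
  induction n generalizing m k l x with
  | zero =>
    cases h
    cases h' with
    | nil => exact ⟨rfl, rfl⟩
    | cons hb hq => exact absurd hq.le hb.lt.not_ge
  | succ n ih =>
    obtain _ | @⟨_, k, _, a, _, ha, hp⟩ := h
    cases h' with
    | nil => exact absurd hp.le ha.lt.not_ge
    | @cons m l _ b _ hb hq =>
      by_cases hab : a = b
      · subst hab
        obtain ⟨rfl, rfl⟩ := ih hp hq
        exact ⟨rfl, rfl⟩
      · have hsup : a ⊔ b = x := ha.wcovBy.sup_eq hb.wcovBy hab
        have hda : a ⊓ b ⋖ a := inf_covBy_of_covBy_sup_right (hsup.symm ▸ hb)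
        have hdb : a ⊓ b ⋖ b := inf_covBy_of_covBy_sup_left (hsup.symm ▸ ha)
        obtain ⟨j, e, hd⟩ := hp.exists_of_mem_Icc (le_inf hp.le hq.le) inf_le_left
        obtain ⟨rfl, rfl⟩ := ih hp (cons hda hd)
        obtain ⟨rfl, rfl⟩ := ih (cons hdb hd) hq
        have h₁ := hc x a b _ ha hb hda hdb
        have h₂ := hc x b a _ hb ha hdb hda
        exact ⟨rfl, by omega⟩

end WeightedCovPath

open scoped Classical in
theorem chainCnt_eq_sum {L : Type*} [PartialOrder L] (t : L → L) (w : ℕ → L) (r : ℕ)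
    (p : L × L) :
    chainCnt t w r p =
      ∑ i ∈ Finset.range r, if CPeq t (w i, w (i + 1)) p then 1 else 0 := by
  rw [← Finset.card_filter, ← Set.ncard_coe_finset, chainCnt]
  congr 1
  ext i
  simp

/-- If `(L, τ⁻¹)` satisfies (c0)–(c4) and `w, w'` are covering chains in `L`
with the same first element and the same last element, then `φ(w, λ) = φ(w', λ)` for every
class `λ ∈ Λ` (represented by a covering pair `p`). -/
theorem stmt7 {L : Type*} [DistribLattice L] [OrderTop L] [Infinite L] (t : L → L)
    (ht : TauMap t) (hc0 : CondC0 t) (hc1 : CondC1 t) (hc2 : CondC2 t) (hc3 : CondC3 t)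
    (hc4 : CondC4 t) (w w' : ℕ → L) (r r' : ℕ)
    (hw : IsCovChain w r) (hw' : IsCovChain w' r')
    (hfirst : w 0 = w' 0) (hlast : w r = w' r') :
    ∀ p : L × L, p.2 ⋖ p.1 → chainCnt t w r p = chainCnt t w' r' p := by
  classical
  intro p _
  rw [chainCnt_eq_sum, chainCnt_eq_sum]
  have h := WeightedCovPath.of_isCovChain (fun x y => if CPeq t (x, y) p then 1 else 0) r w hw
  have h' := WeightedCovPath.of_isCovChain (fun x y => if CPeq t (x, y) p then 1 else 0) r' w' hw'
  rw [← hfirst, ← hlast] at h'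
  refine (h.unique (fun x a b d ha hb hda hdb => ?_) h').2
  have hgen : CPeq t (x, a) (b, d) := .rel _ _ (.inr ⟨ha, hdb, hb, hda⟩)
  exact if_congr ⟨fun hx => (hgen.symm).trans _ _ _ hx, fun hx => hgen.trans _ _ _ hx⟩ rfl rfl
end

section
/- If (L,τ⁻¹) satisfies conditions (c0)–(c4), then for all λ₁, λ₂ ∈ Λ, λ₁ ≤ λ₂ holds if and only if φ(x(λ₁))_{λ₂} = 0. -/
theorem CPeq.congr_left {L : Type*} [PartialOrder L] {t : L → L} {u v : L × L} (p : L × L)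
    (h : CPeq t u v) : CPeq t u p ↔ CPeq t v p :=
  ⟨fun k => (h.symm _ _).trans _ _ _ k, fun k => h.trans _ _ _ k⟩

/-- Opposite sides of a diamond of covers are equivalent covering pairs. -/
theorem CPeq.of_diamond {L : Type*} [PartialOrder L] {t : L → L} {a b c d : L}
    (hcd : c ⋖ d) (hba : b ⋖ a) (had : a ⋖ d) (hbc : b ⋖ c) : CPeq t (d, c) (a, b) :=
  .rel _ _ (Or.inr ⟨hcd, hba, had, hbc⟩)

/-- Transposed covering pairs are equivalent. -/
theorem CPeq.of_transpose {L : Type*} [DistribLattice L] [WellFoundedGT L] [IsStronglyAtomic L]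
    (t : L → L) {a b c : L} (hab : b ⋖ a) (hca : c ≤ a) (hsup : b ⊔ c = a) :
    c ⊓ b ⋖ c ∧ CPeq t (a, b) (c, c ⊓ b) := by
  induction c using WellFoundedGT.induction with
  | ind c ih =>
    rcases hca.eq_or_lt with rfl | hlt
    · rw [inf_eq_right.2 hab.le]
      exact ⟨hab, .refl _⟩
    obtain ⟨d, hcd, hda⟩ := exists_covBy_le_of_lt hlt
    have hds : b ⊔ d = a :=
      le_antisymm (sup_le hab.le hda) (hsup ▸ sup_le_sup_left hcd.le b)
    obtain ⟨h1, h2⟩ := ih d hcd.lt hda hds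
    have hcb : ¬ c ≤ b := fun h => hab.lt.ne (by rw [← hsup, sup_eq_left.2 h])
    have hne : c ≠ d ⊓ b := fun h => hcb (h.le.trans inf_le_right)
    have hs : c ⊔ d ⊓ b = d := by
      refine (hcd.eq_or_eq le_sup_left (sup_le hcd.le inf_le_left)).resolve_left fun h => ?_
      exact hne ((h1.eq_or_eq (sup_eq_left.1 h) hcd.le).resolve_right hcd.lt.ne)
    have hi : c ⊓ (d ⊓ b) = c ⊓ b := by rw [← inf_assoc, inf_eq_left.2 hcd.le]
    have h3 : c ⊓ b ⋖ c := by
      rw [← hi]; exact inf_covBy_of_covBy_sup_right (by rw [hs]; exact h1)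
    have h4 : c ⊓ b ⋖ d ⊓ b := by
      rw [← hi]; exact inf_covBy_of_covBy_sup_left (by rw [hs]; exact hcd)
    exact ⟨h3, h2.trans _ _ _ (CPeq.of_diamond h1 h3 hcd h4)⟩

open scoped Classical in
/-- `f` vanishes at the top and grows by one along exactly the covering pairs equivalent to `p`. -/
def IsPotential {L : Type*} [PartialOrder L] [OrderTop L] (t : L → L) (p : L × L)
    (f : L → ℕ) : Prop :=
  f ⊤ = 0 ∧ ∀ a b, b ⋖ a → f b = f a + if CPeq t (a, b) p then 1 else 0

open scoped Classical in
theorem exists_isPotential {L : Type*} [DistribLattice L] [OrderTop L] [WellFoundedGT L]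
    (t : L → L) (p : L × L) : ∃ f, IsPotential t p f := by
  let F : (b : L) → ((a : L) → a > b → ℕ) → ℕ := fun b ih =>
    if h : ∃ a, b ⋖ a then
      ih h.choose h.choose_spec.lt + if CPeq t (h.choose, b) p then 1 else 0
    else 0
  let f : L → ℕ := IsWellFounded.fix (· > ·) F
  have hf : ∀ b, f b = F b fun a _ => f a := fun b => IsWellFounded.fix_eq _ _ _
  refine ⟨f, ?_, fun a b => ?_⟩
  · rw [hf]
    exact dif_neg fun ⟨a, ha⟩ => not_top_lt ha.lt
  induction b using WellFoundedGT.induction generalizing a with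
  | ind b ih =>
    intro hba
    have hex : ∃ a, b ⋖ a := ⟨a, hba⟩
    obtain ⟨c, hbc, hfb⟩ : ∃ c, b ⋖ c ∧ f b = f c + if CPeq t (c, b) p then 1 else 0 :=
      ⟨hex.choose, hex.choose_spec, by rw [hf]; exact dif_pos hex⟩
    by_cases hca : c = a
    · rw [hfb, hca]
    have hinf : a ⊓ c = b := by
      refine (hba.eq_or_eq (le_inf hba.le hbc.le) inf_le_left).resolve_right fun h => ?_
      exact hca ((hbc.eq_or_eq hba.le (inf_eq_left.1 h)).resolve_left hba.lt.ne').symm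
    have hc : c ⋖ a ⊔ c := covBy_sup_of_inf_covBy_left (hinf.symm ▸ hba)
    have ha : a ⋖ a ⊔ c := covBy_sup_of_inf_covBy_right (hinf.symm ▸ hbc)
    have e1 := ih a hba.lt _ ha
    have e2 := ih c hbc.lt _ hc
    simp only [(CPeq.of_diamond (t := t) ha hbc hc hba).congr_left p] at e1
    simp only [(CPeq.of_diamond (t := t) hc hba ha hbc).congr_left p] at e2
    omega

theorem exists_isCovChain_top {L : Type*} [PartialOrder L] [OrderTop L] [WellFoundedGT L]
    [IsStronglyAtomic L] (x : L) :
    ∃ (w : ℕ → L) (r : ℕ), w 0 = ⊤ ∧ w r = x ∧ IsCovChain w r := by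
  induction x using WellFoundedGT.induction with
  | ind x ih =>
    rcases eq_or_ne x ⊤ with rfl | hx
    · exact ⟨fun _ => ⊤, 0, rfl, rfl, fun i hi => absurd hi (Nat.not_lt_zero i)⟩
    obtain ⟨y, hxy, -⟩ := exists_covBy_le_of_lt hx.lt_top
    obtain ⟨w, r, h0, hr, hw⟩ := ih y hxy.lt
    refine ⟨fun i => if i ≤ r then w i else x, r + 1, by simp [h0], by simp, fun i hi => ?_⟩
    rcases (Nat.lt_succ_iff.1 hi).eq_or_lt with rfl | hlt
    · simpa [hr] using hxy
    · simpa [hlt.le, Nat.succ_le_of_lt hlt] using hw i hlt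

theorem IsPotential.add_eq_add {L : Type*} [PartialOrder L] [OrderTop L] {t : L → L}
    {p : L × L} {f : L → ℕ} (hf : IsPotential t p f) {a b c d : L} (hba : b ⋖ a) (hdc : d ⋖ c)
    (h : CPeq t (a, b) (c, d)) : f b + f c = f a + f d := by
  classical
  have e1 := hf.2 _ _ hba
  have e2 := hf.2 _ _ hdc
  simp only [h.congr_left p] at e1
  omega

theorem IsPotential.chainCnt_add {L : Type*} [PartialOrder L] [OrderTop L] {t : L → L}
    {p : L × L} {f : L → ℕ} (hf : IsPotential t p f) (w : ℕ → L) (r : ℕ) (hw : IsCovChain w r) :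
    f (w r) = f (w 0) + chainCnt t w r p := by
  classical
  have hcard : ∀ n, chainCnt t w n p =
      ((Finset.range n).filter fun i => CPeq t (w i, w (i + 1)) p).card := fun n => by
    rw [chainCnt, ← Set.ncard_coe_finset]
    congr 1
    ext i
    simp
  induction r with
  | zero => simp [hcard]
  | succ r ih =>
    rw [hf.2 _ _ (hw r r.lt_succ_self), ih fun i hi => hw i (hi.trans r.lt_succ_self), hcard,
      hcard, Finset.range_add_one, Finset.filter_insert]
    split_ifs
    · rw [Finset.card_insert_of_notMem (by simp)]; omega
    · omega

theorem isPotential_phi {L : Type*} [DistribLattice L] [OrderTop L] [WellFoundedGT L]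
    [IsStronglyAtomic L] (t : L → L) (p : L × L) : IsPotential t p fun x => phi t x p := by
  obtain ⟨f, hf⟩ := exists_isPotential t p
  suffices (fun x => phi t x p) = f by rwa [this]
  funext x
  have h := exists_isCovChain_top x
  obtain ⟨h0, hr, hw⟩ := h.choose_spec.choose_spec
  have hcnt := hf.chainCnt_add _ _ hw
  calc phi t x p = chainCnt t h.choose h.choose_spec.choose p := dif_pos h
    _ = f (h.choose h.choose_spec.choose) := by rw [hcnt, congrArg f h0, hf.1, zero_add]
    _ = f x := congrArg f hr

theorem apply_iterate_of_apply_eq_add_one {α : Type*} {t : α → α} {f : α → ℕ}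
    (h : ∀ x, f (t x) = f x + 1) (n : ℕ) (x : α) : f (t^[n] x) = f x + n := by
  induction n with
  | zero => rfl
  | succ n ih => rw [Function.iterate_succ_apply', h, ih, add_assoc]

section Potential

variable {L : Type*} [DistribLattice L] [OrderTop L] [WellFoundedGT L] [IsStronglyAtomic L]
  {t : L → L} {p : L × L} {f : L → ℕ}

theorem IsPotential.antitone (hf : IsPotential t p f) : Antitone f := by
  intro b a hba
  induction b using WellFoundedGT.induction with
  | ind b ih =>
    rcases hba.eq_or_lt with rfl | hlt
    · rfl
    obtain ⟨c, hbc, hca⟩ := exists_covBy_le_of_lt hlt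
    have := hf.2 _ _ hbc
    have := ih c hbc.lt hca
    omega

theorem IsPotential.exists_covBy (hf : IsPotential t p f) {a b : L} (hba : b ≤ a)
    (hne : f b ≠ f a) : ∃ c d, d ⋖ c ∧ b ≤ d ∧ c ≤ a ∧ CPeq t (c, d) p := by
  induction b using WellFoundedGT.induction with
  | ind b ih =>
    obtain ⟨c, hbc, hca⟩ := exists_covBy_le_of_lt (hba.lt_of_ne fun h => hne (h ▸ rfl))
    by_cases h : CPeq t (c, b) p
    · exact ⟨c, b, hbc, le_rfl, hca, h⟩
    have e := hf.2 _ _ hbc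
    rw [if_neg h, add_zero] at e
    obtain ⟨c', d', h1, h2, h3⟩ := ih c hbc.lt hca (e ▸ hne)
    exact ⟨c', d', h1, hbc.le.trans h2, h3⟩

theorem IsPotential.add_eq_sup_add_inf (hf : IsPotential t p f) (x y : L) :
    f x + f y = f (x ⊔ y) + f (x ⊓ y) := by
  induction x using WellFoundedGT.induction with
  | ind x ih =>
    by_cases hyx : y ≤ x
    · rw [sup_eq_left.2 hyx, inf_eq_right.2 hyx]
    obtain ⟨c, hxc, hcs⟩ := exists_covBy_le_of_lt (left_lt_sup.2 hyx)
    have hs : c ⊔ y = x ⊔ y :=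
      le_antisymm (sup_le hcs le_sup_right) (sup_le_sup_right hxc.le y)
    obtain ⟨hcov, heq⟩ := CPeq.of_transpose t hxc (inf_le_left : c ⊓ y ≤ c)
      (by rw [sup_inf_left, sup_eq_right.2 hxc.le, inf_eq_left.2 hcs])
    have hi : c ⊓ y ⊓ x = x ⊓ y := by
      rw [inf_right_comm, inf_eq_right.2 hxc.le]
    rw [hi] at hcov heq
    have e := ih c hxc.lt
    have e1 := hf.add_eq_add hxc hcov heq
    rw [hs] at e
    omega

theorem IsPotential.map_tau (hf : IsPotential t p f) (ht : TauMap t) (htop : ⊤ ∈ TauP t)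
    (hc4 : CondC4 t) (hp : p.2 ⋖ p.1) (x : L) : f (t x) = f x + 1 := by
  induction x using WellFoundedGT.induction with
  | ind x ih =>
    rcases eq_or_ne x ⊤ with rfl | hx
    · obtain ⟨r, w, h0, hr, hw, hinj, hsurj⟩ := hc4 ⊤ htop
      obtain ⟨i, hi, hip⟩ := hsurj p hp
      have hcnt : chainCnt t w r p = 1 := by
        rw [chainCnt, Set.ncard_eq_one]
        refine ⟨i, Set.eq_singleton_iff_unique_mem.2 ⟨⟨hi, hip⟩, fun j ⟨hj, hjp⟩ => ?_⟩⟩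
        by_contra hji
        exact hinj j hj i hi hji (hjp.trans _ _ _ (hip.symm _ _))
      rw [← hr, hf.chainCnt_add w r hw, h0, hcnt]
    obtain ⟨y, hxy, -⟩ := exists_covBy_le_of_lt hx.lt_top
    have e := ih y hxy.lt
    have e1 := hf.add_eq_add hxy (ht.cov _ _ hxy) (.rel _ _ (Or.inl ⟨hxy, rfl⟩))
    omega

theorem IsPotential.eq_of_covBy (hf : IsPotential t p f) (hτ : ∀ x, f (t x) = f x + 1)
    (hc3 : CondC3 t) {z a b : L} (ha : a ⋖ z) (hb : b ⋖ z) (hap : CPeq t (z, a) p)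
    (hbp : CPeq t (z, b) p) : a = b := by
  by_contra hab
  have hs : b ⊔ a = z := by
    refine (ha.eq_or_eq le_sup_right (sup_le hb.le ha.le)).resolve_left fun h => ?_
    exact hab ((hb.eq_or_eq (sup_eq_right.1 h) ha.le).resolve_right ha.lt.ne)
  obtain ⟨hcov, heq⟩ := CPeq.of_transpose t hb ha.le hs
  have e1 := hf.2 _ _ ha
  have e2 := hf.2 _ _ hcov
  rw [if_pos hap] at e1
  rw [if_pos ((heq.congr_left p).1 hbp)] at e2
  have e3 := hf.antitone (le_inf (hc3 z a ha) (hc3 z b hb))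
  have e4 := hτ z
  omega

theorem IsPotential.sup_eq_or_eq (hf : IsPotential t p f) (hτ : ∀ x, f (t x) = f x + 1)
    (hc3 : CondC3 t) (x y : L) : f x = f (x ⊔ y) ∨ f y = f (x ⊔ y) := by
  by_contra! h
  obtain ⟨c, c', hc, hxc, hcs, hcp⟩ := hf.exists_covBy le_sup_left h.1
  obtain ⟨d, d', hd, hyd, hds, hdp⟩ := hf.exists_covBy le_sup_right h.2
  have hz : x ⊔ y ≤ c' ⊔ d' := sup_le_sup hxc hyd
  have hc1 : c' ⊔ c ⊓ d = c := by
    rw [sup_inf_left, sup_eq_right.2 hc.le,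
      inf_eq_left.2 (hcs.trans (hz.trans (sup_le_sup_left hd.le c')))]
  have hd1 : d' ⊔ c ⊓ d = d := by
    rw [sup_inf_left, sup_eq_right.2 hd.le, inf_eq_right.2]
    exact hds.trans (hz.trans (sup_le (hc.le.trans le_sup_right) le_sup_left))
  obtain ⟨h1, h2⟩ := CPeq.of_transpose t hc inf_le_left hc1
  obtain ⟨h3, h4⟩ := CPeq.of_transpose t hd inf_le_right hd1
  have heq := hf.eq_of_covBy hτ hc3 h1 h3 ((h2.congr_left p).1 hcp) ((h4.congr_left p).1 hdp)
  refine h1.lt.ne (le_antisymm inf_le_left ?_)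
  calc c ⊓ d ≤ c ⊓ d ⊓ (c' ⊔ d') := le_inf le_rfl ((inf_le_left.trans hcs).trans hz)
    _ = c ⊓ d ⊓ c' ⊔ c ⊓ d ⊓ d' := inf_sup_left _ _ _
    _ = c ⊓ d ⊓ c' := by rw [← heq, sup_idem]

end Potential

theorem top_mem_tauP {L : Type*} [Lattice L] [OrderTop L] {t : L → L} (ht : TauMap t)
    (hc1 : CondC1 t) : ⊤ ∈ TauP t := by
  rintro ⟨z, hz⟩
  have htop : t ⊤ = ⊤ := top_le_iff.1 (hz.ge.trans ((ht.le_iff z ⊤).1 le_top))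
  obtain ⟨⟨r, q⟩, ⟨hq, hrq⟩, huniq⟩ := hc1 ⊤
  have := huniq (r + 1, q) ⟨hq, by rw [Function.iterate_succ_apply']; exact hrq ▸ htop⟩
  simp at this

theorem le_of_iterate_le_iterate {L : Type*} [Lattice L] {t : L → L} (ht : TauMap t)
    (hc2 : CondC2 t) {p q : L} (hp : p ∈ TauP t) (hq : q ∈ TauP t) {r s : ℕ}
    (h : t^[s] q ≤ t^[r] p) : r ≤ s := by
  by_contra! hsr
  obtain ⟨k, rfl⟩ := Nat.exists_eq_add_of_lt hsr
  rw [add_assoc, Function.iterate_add_apply, ht.iterate_le_iff] at h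
  rcases h.eq_or_lt with rfl | hlt
  · exact hq ⟨_, (Function.iterate_succ_apply' t k p).symm⟩
  · exact hc2 q hq p hp _ k.succ_pos hlt

theorem finite_Ici_of_condC2 {L : Type*} [Lattice L] {t : L → L} (ht : TauMap t)
    (hc0 : CondC0 t) (hc1 : CondC1 t) (hc2 : CondC2 t) (b : L) : (Set.Ici b).Finite := by
  obtain ⟨⟨s, q⟩, ⟨hq, rfl⟩, -⟩ := hc1 b
  refine (((Set.finite_Iic s).prod hc0.2).image fun rp => t^[rp.1] rp.2).subset fun x hx => ?_
  obtain ⟨⟨r, p⟩, ⟨hp, rfl⟩, -⟩ := hc1 x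
  exact ⟨(r, p), ⟨le_of_iterate_le_iterate ht hc2 hp hq hx, hp⟩, rfl⟩

theorem wellFoundedGT_of_finite_Ici {L : Type*} [PartialOrder L]
    (h : ∀ b : L, (Set.Ici b).Finite) : WellFoundedGT L :=
  ⟨Subrelation.wf (r := InvImage (· < ·) fun x : L => (Set.Ici x).ncard)
    (fun {_ b} hab => Set.ncard_lt_ncard (Set.Ici_ssubset_Ici.2 hab) (h b))
    (InvImage.wf _ wellFounded_lt)⟩

theorem isStronglyAtomic_of_finite_Ici {L : Type*} [PartialOrder L]
    (h : ∀ b : L, (Set.Ici b).Finite) : IsStronglyAtomic L where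
  exists_covBy_le_of_lt a b hab := by
    have hfin : (Set.Ioc a b).Finite := (h a).subset fun x hx => hx.1.le
    obtain ⟨c, hc⟩ := hfin.exists_minimal ⟨b, hab, le_rfl⟩
    refine ⟨c, ⟨hc.prop.1, fun d had hdc => ?_⟩, hc.prop.2⟩
    exact hdc.not_ge (hc.le_of_le ⟨had, hdc.le.trans hc.prop.2⟩ hdc.le)

/-- If `(L, τ⁻¹)` satisfies (c0)–(c4), then for all `λ₁, λ₂ ∈ Λ`
(represented by covering pairs `p, q`), `λ₁ ≤ λ₂` holds iff `φ(x(λ₁))_{λ₂} = 0`,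
where `x(λ₁)` is the minimum of `{x ∈ L : φ(x)_{λ₁} = 0}` and
`λ₁ ≤ λ₂` means `φ(x)_{λ₁} ≥ φ(x)_{λ₂}` for all `x ∈ L`. -/
theorem stmt15 {L : Type*} [DistribLattice L] [OrderTop L] [Infinite L] (t : L → L)
    (ht : TauMap t) (hc0 : CondC0 t) (hc1 : CondC1 t) (hc2 : CondC2 t) (hc3 : CondC3 t)
    (hc4 : CondC4 t) :
    ∀ p q : L × L, p.2 ⋖ p.1 → q.2 ⋖ q.1 → ∀ m : L,
      IsLeast {x : L | phi t x p = 0} m →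
      ((∀ x : L, phi t x q ≤ phi t x p) ↔ phi t m q = 0) := by
  have hfin := finite_Ici_of_condC2 ht hc0 hc1 hc2
  have := wellFoundedGT_of_finite_Ici hfin
  have := isStronglyAtomic_of_finite_Ici hfin
  have htop := top_mem_tauP ht hc1
  intro p q hp hq m hm
  refine ⟨fun h => Nat.le_zero.1 ((h m).trans_eq hm.1), fun hmq x => ?_⟩
  have hfp := isPotential_phi t p
  have hfq := isPotential_phi t q
  have hτp := hfp.map_tau ht htop hc4 hp
  have hτq := hfq.map_tau ht htop hc4 hq
  set n := phi t x p
  have htopn : phi t (t^[n] ⊤) p = n := by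
    have := apply_iterate_of_apply_eq_add_one (f := (phi t · p)) hτp n ⊤
    have h0 : phi t ⊤ p = 0 := hfp.1
    simpa [h0] using this
  have hinf : phi t (x ⊓ t^[n] ⊤) p = n := by
    have h1 := hfp.add_eq_sup_add_inf x (t^[n] ⊤)
    have h2 := hfp.sup_eq_or_eq hτp hc3 x (t^[n] ⊤)
    omega
  obtain ⟨⟨r, u⟩, ⟨hu, hru⟩, -⟩ := hc1 (x ⊓ t^[n] ⊤)
  obtain ⟨k, rfl⟩ := Nat.exists_eq_add_of_le
    (le_of_iterate_le_iterate ht hc2 htop hu (hru.le.trans inf_le_right))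
  rw [Function.iterate_add_apply] at hru
  have hz : phi t (t^[k] u) p = 0 := by
    have := apply_iterate_of_apply_eq_add_one (f := (phi t · p)) hτp n (t^[k] u)
    simp only [hru] at this
    omega
  have hle : t^[n] m ≤ x :=
    ((ht.iterate_le_iff n _ _).2 (hm.2 hz)).trans (hru.le.trans inf_le_left)
  have h1 : phi t x q ≤ phi t (t^[n] m) q := hfq.antitone hle
  have h2 := apply_iterate_of_apply_eq_add_one (f := (phi t · q)) hτq n m
  simp only [hmq] at h2
  omega
end
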